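/- There is no self-descriptive number in base 6; that is, no natural number n is self-descriptive in base 6. -/

import Mathlib

/-- `n` is self-descriptive in base `b`: its base-`b` digit list has length exactly `b`,
and for every `i < b`, the digit at position `i` counted from the most significant digit
(i.e. the coefficient of `b ^ (b - 1 - i)`) equals the number of occurrences of the
value `i` among the base-`b` digits of `n`. -/
def IsSelfDescriptive (b n : ℕ) : Prop :=
  (Nat.digits b n).length = b ∧
  ∀ i < b, n / b ^ (b - 1 - i) % b = (Nat.digits b n).count i

theorem sd_six_delta (x : ℕ) (hx : x < 6) :
    [x].count 0 + [x].count 1 + [x].count 2 + [x].count 3 + [x].count 4 + [x].count 5 = 1 ∧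
    [x].count 1 + 2 * [x].count 2 + 3 * [x].count 3 + 4 * [x].count 4 + 5 * [x].count 5 = x := by
  interval_cases x <;> decide

theorem sd_six_split (a b c d e f i : ℕ) : [a, b, c, d, e, f].count i =
    [a].count i + [b].count i + [c].count i + [d].count i + [e].count i + [f].count i := by
  simp only [List.count_cons, List.count_nil]; omega

theorem sd_six_aux (a b c d e f : ℕ) (ha : a < 6) (hb : b < 6) (hc : c < 6) (hd : d < 6)
    (he : e < 6) (hf : f < 6)
    (h0 : f = [a, b, c, d, e, f].count 0) (h1 : e = [a, b, c, d, e, f].count 1)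
    (h2 : d = [a, b, c, d, e, f].count 2) (h3 : c = [a, b, c, d, e, f].count 3)
    (h4 : b = [a, b, c, d, e, f].count 4) (h5 : a = [a, b, c, d, e, f].count 5) : False := by
  have key : a + b + c + d + e + f = 6 ∧ 5 * a + 4 * b + 3 * c + 2 * d + e = 6 := by
    have k0 := h0
    have k1 := h1
    have k2 := h2
    have k3 := h3
    have k4 := h4
    have k5 := h5
    rw [sd_six_split] at k0 k1 k2 k3 k4 k5
    have := sd_six_delta a ha
    have := sd_six_delta b hb
    have := sd_six_delta c hc
    have := sd_six_delta d hd
    have := sd_six_delta e he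
    have := sd_six_delta f hf
    constructor <;> linarith
  obtain ⟨s1, s2⟩ := key
  have a1 : a ≤ 1 := by omega
  have b1 : b ≤ 1 := by omega
  have c1 : c ≤ 2 := by omega
  have d1 : d ≤ 3 := by omega
  have e1 : e = 6 - (5 * a + 4 * b + 3 * c + 2 * d) := by omega
  have f1 : f = 6 - (a + b + c + d + e) := by omega
  clear ha hb hc hd
  interval_cases a <;> interval_cases b <;> interval_cases c <;> interval_cases d <;>
    first
    | omega
    | (norm_num at e1; subst e1; norm_num at f1; subst f1; revert he hf h0 h1 h2 h3 h4 h5; decide)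

theorem no_selfDescriptive_base_six : ¬ ∃ n : ℕ, IsSelfDescriptive 6 n := by
  rintro ⟨n, hlen, h⟩
  have hlt : ∀ x ∈ Nat.digits 6 n, x < 6 := fun x hx => Nat.digits_lt_base (by norm_num) hx
  have hg : ∀ i < 6, (Nat.digits 6 n).getD (6 - 1 - i) 0 = (Nat.digits 6 n).count i := by
    intro i hi
    rw [Nat.getD_digits _ _ (by norm_num)]
    exact h i hi
  generalize Nat.digits 6 n = l at hlen hlt hg
  match l, hlen, hlt, hg with
  | [a, b, c, d, e, f], _, hlt, hg =>
    exact sd_six_aux a b c d e f (hlt a (by simp)) (hlt b (by simp)) (hlt c (by simp))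
      (hlt d (by simp)) (hlt e (by simp)) (hlt f (by simp))
      (hg 0 (by norm_num)) (hg 1 (by norm_num)) (hg 2 (by norm_num)) (hg 3 (by norm_num))
      (hg 4 (by norm_num)) (hg 5 (by norm_num))
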